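/- Let x ∈ D ⊆ 𝒟 with E_f(x) ∈ J satisfy the coordinatewise inequality ‖x − T(x)‖ ⪯ γ(E_f(x))·‖W_f(x)‖, where γ : J → ℝ₊ is such that ψ(t) = 1 − b·t·γ(t) is positive on J. Then, writing x̂ = T(x), for all i ≠ j one has |x̂_i − x̂_j| ≥ ψ(E_f(x))·d_i(x) > 0; in particular T(x) has pairwise distinct components, i.e. T(x) ∈ 𝒟. (Theorem 2.1 (i),(ii)) -/

import Mathlib

open Finset Polynomial Filter

noncomputable section

/-- The Weierstrass correction `W_i(x) = f(x_i)/(C₀ ∏_{j≠i}(x_i − x_j))`. -/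
def Wc {n : ℕ} {K : Type*} [NormedField K] (f : Polynomial K) (x : Fin n → K) (i : Fin n) : K :=
  eval (x i) f / (f.leadingCoeff * ∏ j ∈ univ.erase i, (x i - x j))

/-- `dmin x i = min_{j ≠ i} ‖x i - x j‖`. -/
def dmin {n : ℕ} {K : Type*} [NormedField K] (x : Fin n → K) (i : Fin n) : ℝ :=
  if h : (univ.erase i).Nonempty then (univ.erase i).inf' h fun j => ‖x i - x j‖ else 0

/-- `E_f(x)` : the ℓ^p norm of the vector `(‖W_i(x)‖ / d_i(x))_i`. -/
def Ef {n : ℕ} {K : Type*} [NormedField K] (p : ENNReal) (f : Polynomial K)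
    (x : Fin n → K) : ℝ :=
  ‖(WithLp.equiv p (Fin n → ℝ)).symm (fun i => ‖Wc f x i‖ / dmin x i)‖

/-- `σ_i(x) = Σ_{j≠i} W_j(x)/(x_i − x_j)`. -/
def sigmaf {n : ℕ} {K : Type*} [NormedField K] (f : Polynomial K) (x : Fin n → K)
    (i : Fin n) : K :=
  ∑ j ∈ univ.erase i, Wc f x j / (x i - x j)

/-- The Ehrlich iteration function. -/
def PhiE {n : ℕ} {K : Type*} [NormedField K] (f : Polynomial K) (x : Fin n → K) : Fin n → K :=
  fun i => x i - Wc f x i / (1 + sigmaf f x i)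

/-- The Prešić–Tanabe iteration function. -/
def TnbE {n : ℕ} {K : Type*} [NormedField K] (f : Polynomial K) (x : Fin n → K) : Fin n → K :=
  fun i => x i - Wc f x i * (1 - sigmaf f x i)

/-- `ξ` is a root vector of `f`, i.e. `f(z) = C₀ ∏ (z − ξᵢ)`. -/
def IsRootVector {n : ℕ} {K : Type*} [NormedField K] (f : Polynomial K) (ξ : Fin n → K) : Prop :=
  f = C f.leadingCoeff * ∏ i, (X - C (ξ i))

/-- `E_f(x)` in the case `p = ∞`: the max of `‖W_i(x)‖ / d_i(x)`. -/
def Einf {n : ℕ} {K : Type*} [NormedField K] (f : Polynomial K) (x : Fin n → K) : ℝ :=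
  if h : (univ : Finset (Fin n)).Nonempty then univ.sup' h fun i => ‖Wc f x i‖ / dmin x i else 0

/-- Hölder's inequality for two distinct coordinates of a vector in `ℓ^p`. -/
lemma PiLp.norm_apply_add_norm_apply_le {ι : Type*} [Fintype ι] {p q : ENNReal} (hp : 1 ≤ p)
    (hpq : p⁻¹ + q⁻¹ = 1) (u : PiLp p fun _ : ι => ℝ) {i j : ι} (hij : i ≠ j) :
    ‖u i‖ + ‖u j‖ ≤ 2 ^ q⁻¹.toReal * ‖u‖ := by
  classical
  have : Fact (1 ≤ p) := ⟨hp⟩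
  rcases eq_or_ne p ⊤ with rfl | hp_top
  · have hq : q⁻¹ = 1 := by simpa using hpq
    have hi := PiLp.norm_apply_le u i
    have hj := PiLp.norm_apply_le u j
    rw [hq, ENNReal.toReal_one, Real.rpow_one]
    linarith
  · have hr : 1 ≤ p.toReal := by simpa using ENNReal.toReal_mono hp_top hp
    have hr0 : 0 < p.toReal := by linarith
    have hp_inv : p⁻¹ ≠ ⊤ := ENNReal.inv_ne_top.2 (zero_lt_one.trans_le hp).ne'
    have hq_inv : q⁻¹ ≠ ⊤ := fun h => by simp [h] at hpq
    have hexp : q⁻¹.toReal = 1 - p.toReal⁻¹ := by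
      have h := congrArg ENNReal.toReal hpq
      rw [ENNReal.toReal_add hp_inv hq_inv, ENNReal.toReal_inv p, ENNReal.toReal_one] at h
      linarith
    have hpow : (‖u i‖ + ‖u j‖) ^ p.toReal ≤ (2 ^ q⁻¹.toReal * ‖u‖) ^ p.toReal := by
      calc (‖u i‖ + ‖u j‖) ^ p.toReal
          ≤ 2 ^ (p.toReal - 1) * (‖u i‖ ^ p.toReal + ‖u j‖ ^ p.toReal) :=
            by exact_mod_cast NNReal.rpow_add_le_mul_rpow_add_rpow ‖u i‖₊ ‖u j‖₊ hr
        _ ≤ 2 ^ (p.toReal - 1) * ∑ k, ‖u k‖ ^ p.toReal := by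
            gcongr
            rw [← Finset.sum_pair (f := fun k => ‖u k‖ ^ p.toReal) hij]
            exact Finset.sum_le_univ_sum_of_nonneg fun k => by positivity
        _ = (2 ^ q⁻¹.toReal * ‖u‖) ^ p.toReal := by
            rw [PiLp.norm_eq_sum hr0, Real.mul_rpow (by positivity) (by positivity),
              ← Real.rpow_mul (by positivity), ← Real.rpow_mul (by positivity),
              one_div_mul_cancel hr0.ne', Real.rpow_one, hexp, sub_mul,
              inv_mul_cancel₀ hr0.ne', one_mul]
    exact (Real.rpow_le_rpow_iff (by positivity) (by positivity) hr0).1 hpow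

lemma dmin_le {n : ℕ} {K : Type*} [NormedField K] (x : Fin n → K) {i j : Fin n} (hij : i ≠ j) :
    dmin x i ≤ ‖x i - x j‖ := by
  have hj : j ∈ univ.erase i := by simp [hij.symm]
  have hne : (univ.erase i).Nonempty := ⟨j, hj⟩
  rw [dmin, dif_pos hne]
  exact Finset.inf'_le _ hj

lemma dmin_pos {n : ℕ} {K : Type*} [NormedField K] {x : Fin n → K} (hx : Function.Injective x)
    {i j : Fin n} (hij : i ≠ j) : 0 < dmin x i := by
  have hj : j ∈ univ.erase i := by simp [hij.symm]
  have hne : (univ.erase i).Nonempty := ⟨j, hj⟩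
  rw [dmin, dif_pos hne, Finset.lt_inf'_iff]
  intro k hk
  exact norm_pos_iff.2 (sub_ne_zero.2 fun h => (Finset.ne_of_mem_erase hk) (hx h).symm)

lemma norm_Wc_add_norm_Wc_le {n : ℕ} {K : Type*} [NormedField K] {p q : ENNReal} (hp : 1 ≤ p)
    (hpq : p⁻¹ + q⁻¹ = 1) (f : Polynomial K) {x : Fin n → K} (hx : Function.Injective x)
    {i j : Fin n} (hij : i ≠ j) :
    ‖Wc f x i‖ + ‖Wc f x j‖ ≤ 2 ^ q⁻¹.toReal * Ef p f x * ‖x i - x j‖ := by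
  have bound {k l : Fin n} (hkl : k ≠ l) :
      ‖Wc f x k‖ ≤ ‖‖Wc f x k‖ / dmin x k‖ * ‖x k - x l‖ := by
    have hd := dmin_pos hx hkl
    rw [Real.norm_of_nonneg (by positivity)]
    calc ‖Wc f x k‖ = ‖Wc f x k‖ / dmin x k * dmin x k := (div_mul_cancel₀ _ hd.ne').symm
      _ ≤ ‖Wc f x k‖ / dmin x k * ‖x k - x l‖ := by gcongr; exact dmin_le x hkl
  calc ‖Wc f x i‖ + ‖Wc f x j‖
      ≤ (‖‖Wc f x i‖ / dmin x i‖ + ‖‖Wc f x j‖ / dmin x j‖) * ‖x i - x j‖ := by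
        rw [add_mul]
        exact add_le_add (bound hij) (norm_sub_rev (x i) (x j) ▸ bound hij.symm)
    _ ≤ 2 ^ q⁻¹.toReal * Ef p f x * ‖x i - x j‖ :=
        mul_le_mul_of_nonneg_right (PiLp.norm_apply_add_norm_apply_le hp hpq
          ((WithLp.equiv p (Fin n → ℝ)).symm fun i => ‖Wc f x i‖ / dmin x i) hij)
          (norm_nonneg _)

/-- Proinov, Theorem 2.1 (i),(ii). -/
theorem stmt_0 {n : ℕ} {K : Type*} [NormedField K] [CompleteSpace K] (hn : 2 ≤ n)
    (f : Polynomial K) (hdeg : f.degree = (n : ℕ))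
    (p q : ENNReal) (hp : 1 ≤ p) (hpq : p⁻¹ + q⁻¹ = 1)
    (b : ℝ) (hb : b = (2 : ℝ) ^ (ENNReal.toReal q⁻¹))
    (J : Set ℝ) (hJ0 : (0 : ℝ) ∈ J) (hJsub : J ⊆ Set.Ici (0 : ℝ)) (hJconn : J.OrdConnected)
    (γ : ℝ → ℝ) (hγ : ∀ t ∈ J, 0 ≤ γ t) (hψ : ∀ t ∈ J, 0 < 1 - b * t * γ t)
    (D : Set (Fin n → K)) (hD : ∀ y ∈ D, Function.Injective y)
    (T : (Fin n → K) → Fin n → K)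
    (x : Fin n → K) (hxD : x ∈ D) (hxE : Ef p f x ∈ J)
    (hmain : ∀ i, ‖x i - T x i‖ ≤ γ (Ef p f x) * ‖Wc f x i‖) :
    (∀ i j : Fin n, i ≠ j →
      0 < (1 - b * Ef p f x * γ (Ef p f x)) * dmin x i ∧
      (1 - b * Ef p f x * γ (Ef p f x)) * dmin x i ≤ ‖T x i - T x j‖) ∧
    Function.Injective (T x) := by
  have hx := hD x hxD
  have hψE := hψ _ hxE
  have hγE := hγ _ hxE
  have key : ∀ i j : Fin n, i ≠ j →
      0 < (1 - b * Ef p f x * γ (Ef p f x)) * dmin x i ∧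
      (1 - b * Ef p f x * γ (Ef p f x)) * dmin x i ≤ ‖T x i - T x j‖ := by
    intro i j hij
    refine ⟨mul_pos hψE (dmin_pos hx hij), ?_⟩
    have htri : ‖x i - x j‖ ≤ ‖x i - T x i‖ + ‖T x i - T x j‖ + ‖x j - T x j‖ := by
      rw [norm_sub_rev (x j)]
      calc ‖x i - x j‖ = ‖(x i - T x i) + (T x i - T x j) + (T x j - x j)‖ := by
            congr 1; ring
        _ ≤ _ := norm_add₃_le
    have hW := mul_le_mul_of_nonneg_left (norm_Wc_add_norm_Wc_le hp hpq f hx hij) hγE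
    rw [← hb] at hW
    calc (1 - b * Ef p f x * γ (Ef p f x)) * dmin x i
        ≤ (1 - b * Ef p f x * γ (Ef p f x)) * ‖x i - x j‖ :=
          mul_le_mul_of_nonneg_left (dmin_le x hij) hψE.le
      _ ≤ ‖T x i - T x j‖ := by linarith [hmain i, hmain j]
  refine ⟨key, fun i j h => ?_⟩
  by_contra hij
  obtain ⟨hpos, hle⟩ := key i j hij
  rw [h, sub_self, norm_zero] at hle
  exact hpos.not_ge hle
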